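/- arXiv:1802.02486 — 2 statements merged into one kernel-verified Lean document; each statement's English description precedes it below -/
import Mathlib

section
/- Let 𝒜 be a unital spectral *-algebra, X ∈ M_N(𝒜) a positive quantum control with Tr(X) ∈ Z(𝒜). Then X and Tr(X) are bounded equivalent: for every irreducible admissible representation π one has ‖π(Tr(X))‖ ≤ N‖π(X)‖ and ‖π(X)‖ ≤ N‖π(Tr(X))‖. Consequently 𝒜 is an s*-algebra with central control Tr(X). -/
open scoped Matrix

lemma aux_sum_sq {B : Type*} [CStarAlgebra B] [PartialOrder B] [StarOrderedRing B]
    {N : ℕ} (a : Fin N → B) :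
    star (∑ i, a i) * (∑ i, a i) ≤ (N : ℝ) • ∑ i, star (a i) * a i := by
  have h : 0 ≤ ∑ i, ∑ j, star (a i - a j) * (a i - a j) :=
    Finset.sum_nonneg fun i _ => Finset.sum_nonneg fun j _ => star_mul_self_nonneg _
  have e : ∑ i, ∑ j, star (a i - a j) * (a i - a j)
      = (2 : ℝ) • ((N : ℝ) • ∑ i, star (a i) * a i - star (∑ i, a i) * (∑ i, a i)) := by
    have h1 : ∑ i, ∑ j, star (a i) * a j = star (∑ i, a i) * (∑ i, a i) := by
      rw [star_sum, Finset.sum_mul_sum]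
    have h2 : ∑ i, ∑ j, star (a j) * a i = star (∑ i, a i) * (∑ i, a i) := by
      rw [Finset.sum_comm, h1]
    have h3 : ∀ i j, star (a i - a j) * (a i - a j)
        = star (a i) * a i + star (a j) * a j - star (a i) * a j - star (a j) * a i := by
      intro i j
      rw [star_sub]
      noncomm_ring
    simp only [h3, Finset.sum_sub_distrib, Finset.sum_add_distrib, h1, h2, Finset.sum_const,
      Finset.card_univ, Fintype.card_fin, ← Finset.smul_sum, ← Nat.cast_smul_eq_nsmul ℝ]
    module
  rw [e] at h
  have h' := smul_nonneg (show (0 : ℝ) ≤ 1 / 2 by norm_num) h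
  rw [smul_smul] at h'
  norm_num at h'
  rw [star_sum]
  exact h'

lemma aux_main {𝒜 : Type*} [Ring 𝒜] [StarRing 𝒜] [Algebra ℂ 𝒜] [StarModule ℂ 𝒜]
    {N : ℕ} (X : Matrix (Fin N) (Fin N) 𝒜)
    {B : Type*} [CStarAlgebra B] [PartialOrder B] [StarOrderedRing B]
    (ρ : Matrix (Fin N) (Fin N) 𝒜 →⋆ₐ[ℂ] B)
    (hpos : ∃ y : B, ρ X = star y * y) :
    ‖ρ (Matrix.scalar (Fin N) (Matrix.trace X))‖ ≤ N * ‖ρ X‖ ∧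
      ‖ρ X‖ ≤ N * ‖ρ (Matrix.scalar (Fin N) (Matrix.trace X))‖ := by
  obtain ⟨y, hy⟩ := hpos
  have hx : 0 ≤ ρ X := hy ▸ star_mul_self_nonneg y
  let e : Fin N → Fin N → B := fun i j => ρ (Matrix.single i j 1)
  have hstar : ∀ i j, star (e i j) = e j i := by
    intro i j
    simp only [e, ← map_star, Matrix.star_eq_conjTranspose, Matrix.conjTranspose_single, star_one]
  have hT : ρ (Matrix.scalar (Fin N) (Matrix.trace X)) = ∑ i, ∑ j, e i j * ρ X * e j i := by
    simp only [e, ← map_mul, ← map_sum]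
    congr 1
    ext k l
    simp only [Matrix.sum_apply, Matrix.single_mul_mul_single, Matrix.scalar_apply,
      Matrix.diagonal_apply, Matrix.single_apply, one_mul, mul_one]
    by_cases hkl : k = l
    · subst hkl
      simp [Matrix.trace]
    · rw [if_neg hkl]
      symm
      refine Finset.sum_eq_zero fun i _ => Finset.sum_eq_zero fun j _ => if_neg ?_
      rintro ⟨rfl, rfl⟩
      exact hkl rfl
  have hee : ∀ i j k, e i j * e j k = e i k := by
    intro i j k
    simp only [e, ← map_mul, Matrix.single_mul_single_same, one_mul]
  have hone : ∑ i, e i i = 1 := by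
    simp only [e, ← map_sum, Matrix.sum_single_one, map_one]
  have hterm : ∀ i j, 0 ≤ e i j * ρ X * e j i := by
    intro i j
    rw [← hstar i j]
    exact star_right_conjugate_nonneg hx _
  have hT0 : 0 ≤ ρ (Matrix.scalar (Fin N) (Matrix.trace X)) := by
    rw [hT]
    exact Finset.sum_nonneg fun i _ => Finset.sum_nonneg fun j _ => hterm i j
  have hN1 : ∀ r : ℝ, 0 ≤ r → ‖r • (1 : B)‖ ≤ r := by
    intro r hr
    rw [norm_smul, Real.norm_of_nonneg hr]
    rcases subsingleton_or_nontrivial B with h | h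
    · rw [Subsingleton.elim (1 : B) 0]
      simpa using hr
    · simp
  constructor
  · have hle : ρ (Matrix.scalar (Fin N) (Matrix.trace X)) ≤ (N * ‖ρ X‖) • (1 : B) := by
      have h1 : ρ X ≤ ‖ρ X‖ • (1 : B) := by
        rw [← Algebra.algebraMap_eq_smul_one]
        exact IsSelfAdjoint.le_algebraMap_norm_self (.of_nonneg hx)
      have h2 : ∀ i j, e i j * ρ X * e j i ≤ ‖ρ X‖ • e i i := by
        intro i j
        have := star_right_conjugate_le_conjugate h1 (e i j)
        rwa [hstar, mul_smul_comm, smul_mul_assoc, mul_one, hee] at this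
      rw [hT]
      refine (Finset.sum_le_sum fun i _ => Finset.sum_le_sum fun j _ => h2 i j).trans_eq ?_
      simp only [Finset.sum_const, Finset.card_univ, Fintype.card_fin,
        ← Nat.cast_smul_eq_nsmul ℝ, ← Finset.smul_sum, hone, smul_smul]
    exact (CStarAlgebra.norm_le_norm_of_nonneg_of_le hT0 hle).trans (hN1 _ (by positivity))
  · have hle : ρ X ≤ (N : ℝ) • ρ (Matrix.scalar (Fin N) (Matrix.trace X)) := by
      have h1 := aux_sum_sq fun i => y * e i i
      rw [← Finset.mul_sum, hone, mul_one, ← hy] at h1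
      refine h1.trans (smul_le_smul_of_nonneg_left ?_ (by positivity))
      rw [hT]
      refine Finset.sum_le_sum fun i _ => ?_
      have h2 : star (y * e i i) * (y * e i i) = e i i * ρ X * e i i := by
        rw [star_mul, hstar, hy]
        simp only [mul_assoc]
      rw [h2]
      exact Finset.single_le_sum (f := fun j => e i j * ρ X * e j i)
        (fun j _ => hterm i j) (Finset.mem_univ i)
    refine (CStarAlgebra.norm_le_norm_of_nonneg_of_le hx hle).trans ?_
    rw [norm_smul, Real.norm_of_nonneg (by positivity)]

/-- Bounded equivalence of a positive quantum control `X` and its trace.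
Let `𝒜` be a unital *-algebra, `X ∈ M_N(𝒜)` with `Tr(X) ∈ Z(𝒜)`.  For each
irreducible admissible representation `p`, the amplification of `π_p` to
matrices is a unital *-homomorphism `ρ p : M_N(𝒜) → C p` into a C*-algebra
(namely `M_N(B(H_p))`); positivity of `X` means each `ρ p X` is positive.
Then `‖π_p(Tr X)‖ ≤ N·‖π_p(X)‖` and `‖π_p(X)‖ ≤ N·‖π_p(Tr X)‖` for every `p`,
where `π_p(Tr X)` is the image of the constant diagonal matrix
`Matrix.scalar (Tr X)`.  (Consequently `X` and `Tr X` are bounded equivalent,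
so `𝒜` is an s*-algebra with central control `Tr X`.) -/
theorem trace_of_positive_quantum_control_bounded_equivalent
    {𝒜 : Type*} [Ring 𝒜] [StarRing 𝒜] [Algebra ℂ 𝒜] [StarModule ℂ 𝒜]
    {N : ℕ} (X : Matrix (Fin N) (Fin N) 𝒜)
    (hcentral : Matrix.trace X ∈ Set.center 𝒜)
    {P : Type*} (C : P → Type*) [∀ p, NormedRing (C p)] [∀ p, StarRing (C p)]
    [∀ p, CStarRing (C p)] [∀ p, NormedAlgebra ℂ (C p)] [∀ p, CompleteSpace (C p)]
    [∀ p, StarModule ℂ (C p)]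
    (ρ : ∀ p, Matrix (Fin N) (Fin N) 𝒜 →⋆ₐ[ℂ] C p)
    (hpos : ∀ p, ∃ y : C p, ρ p X = star y * y) :
    ∀ p, ‖ρ p (Matrix.scalar (Fin N) (Matrix.trace X))‖ ≤ N * ‖ρ p X‖ ∧
      ‖ρ p X‖ ≤ N * ‖ρ p (Matrix.scalar (Fin N) (Matrix.trace X))‖ := by
  intro p
  letI : CStarAlgebra (C p) := {}
  letI := CStarAlgebra.spectralOrder (C p)
  haveI := CStarAlgebra.spectralOrderedRing (C p)
  exact aux_main X (ρ p) (hpos p)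
end

section
/- Every bounded irreducible admissible representation of 𝒪_q(T_+(N)) ≅ U_q(u(N)) (for 0 < q, q ≠ 1, with all Kᵢ positive) is finite-dimensional: any irreducible *-representation of U_q(u(N)) by bounded operators in which all Kᵢ act as positive operators admits a highest and lowest weight and is finite-dimensional, hence is an irreducible type-1 highest-weight module. -/
namespace UqAux

theorem split_selfAdjoint {V : Type*} [NormedAddCommGroup V] [InnerProductSpace ℂ V]
    [CompleteSpace V] [Nontrivial V] (A : V →L[ℂ] V) (hA : IsSelfAdjoint A)
    (hne : ∀ r : ℝ, A ≠ (r : ℂ) • (1 : V →L[ℂ] V)) :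
    ∃ f g : V →L[ℂ] V, IsSelfAdjoint f ∧ f ≠ 0 ∧ g ≠ 0 ∧ f * g = 0 ∧
      ∀ B : V →L[ℂ] V, Commute A B → Commute g B := by
  have hs : ∃ a ∈ spectrum ℝ A, ∃ b ∈ spectrum ℝ A, a < b := by
    by_contra hcon
    push Not at hcon
    obtain ⟨r, hr⟩ : (spectrum ℝ A).Nonempty := ContinuousFunctionalCalculus.spectrum_nonempty A hA
    apply hne r
    have := CFC.eq_algebraMap_of_spectrum_subset_singleton (R := ℝ) (a := A) r
      (fun x hx => le_antisymm (hcon _ hr _ hx) (hcon _ hx _ hr)) hA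
    rw [this, Algebra.algebraMap_eq_smul_one]
    ext x; simp
  obtain ⟨a, ha, b, hb, hab⟩ := hs
  set c := (a + b) / 2
  refine ⟨cfc (fun x : ℝ => max (x - c) 0) A, cfc (fun x : ℝ => max (c - x) 0) A,
    cfc_predicate _ _, ?_, ?_, ?_, ?_⟩
  · intro h
    rw [← cfc_zero ℝ A] at h
    have h2 := eqOn_of_cfc_eq_cfc (R := ℝ) h (by fun_prop) (by fun_prop) hA hb
    have : max (b - c) 0 = 0 := h2
    have := le_max_left (b - c) 0
    simp only [c] at *; linarith
  · intro h
    rw [← cfc_zero ℝ A] at h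
    have h2 := eqOn_of_cfc_eq_cfc (R := ℝ) h (by fun_prop) (by fun_prop) hA ha
    have : max (c - a) 0 = 0 := h2
    have := le_max_left (c - a) 0
    simp only [c] at *; linarith
  · rw [← cfc_mul _ _ A (by fun_prop) (by fun_prop), ← cfc_zero ℝ A]
    congr 1
    funext x
    simp only [Pi.zero_apply, mul_eq_zero, max_eq_right_iff]
    rcases le_total x c with h | h
    · left; linarith
    · right; linarith
  · intro B hB
    exact hB.cfc_real _

theorem nilp {H : Type*} [NormedAddCommGroup H] [InnerProductSpace ℂ H]
    (X Y : H →L[ℂ] H) (hXY : X * Y = 1) (hYX : Y * X = 1) (c : ℝ) (hc0 : 0 < c) (hc1 : c ≠ 1) :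
    ∃ n0 : ℕ, ∀ n ≥ n0, ∀ P : H →L[ℂ] H, X * P = ((c : ℂ) ^ n) • (P * X) → P = 0 := by
  have key : ∀ (X Y : H →L[ℂ] H), X * Y = 1 → ∀ c : ℝ, 1 < c →
      ∃ n0 : ℕ, ∀ n ≥ n0, ∀ P : H →L[ℂ] H, X * P = ((c : ℂ) ^ n) • (P * X) → P = 0 := by
    intro X Y hXY c hc
    obtain ⟨n0, hn0⟩ := pow_unbounded_of_one_lt (‖X‖ * ‖Y‖) hc
    refine ⟨n0, fun n hn P hP => ?_⟩
    have h1 : X * P * Y = ((c : ℂ) ^ n) • P := by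
      rw [hP, smul_mul_assoc, mul_assoc, hXY, mul_one]
    have h2 : c ^ n * ‖P‖ ≤ ‖X‖ * ‖Y‖ * ‖P‖ := by
      have h3 : ‖((c : ℂ) ^ n) • P‖ = c ^ n * ‖P‖ := by
        rw [norm_smul, norm_pow, Complex.norm_real, Real.norm_of_nonneg (by linarith)]
      rw [← h3, ← h1]
      calc ‖X * P * Y‖ ≤ ‖X‖ * ‖P‖ * ‖Y‖ :=
            (norm_mul_le _ _).trans (by gcongr; exact norm_mul_le _ _)
        _ = _ := by ring
    have h4 : c ^ n0 ≤ c ^ n := pow_le_pow_right₀ hc.le hn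
    by_contra hne
    have h5 : 0 < ‖P‖ := norm_pos_iff.mpr hne
    have := le_of_mul_le_mul_right h2 h5
    linarith
  rcases lt_or_gt_of_ne hc1 with h | h
  · obtain ⟨n0, hn0⟩ := key Y X hYX c⁻¹ ((one_lt_inv₀ hc0).2 h)
    refine ⟨n0, fun n hn P hP => hn0 n hn P ?_⟩
    have hc : (c : ℂ) ^ n ≠ 0 := pow_ne_zero _ (by exact_mod_cast hc0.ne')
    have h1 : P * Y = ((c : ℂ) ^ n) • (Y * P) := by
      calc P * Y = Y * (X * P) * Y := by rw [← mul_assoc, hYX, one_mul]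
        _ = _ := by rw [hP, mul_smul_comm, smul_mul_assoc, mul_assoc, mul_assoc, hXY, mul_one]
    rw [h1, smul_smul]
    push_cast
    rw [inv_pow, inv_mul_cancel₀ hc, one_smul]
  · exact key X Y hXY c h

theorem exists_grading {H : Type*} [NormedAddCommGroup H] [InnerProductSpace ℂ H] {n m : ℕ}
    (q : ℂ) (hq : q ≠ 0) (K Kinv : Fin n → (H →L[ℂ] H)) (G : Fin m → (H →L[ℂ] H))
    (hKinv : ∀ i, K i * Kinv i = 1 ∧ Kinv i * K i = 1)
    (d : Fin n → Fin m → ℤ)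
    (hKG : ∀ i j, K i * G j = q ^ (d i j) • (G j * K i)) (a : Fin n → ℕ) (s : Finset (Fin n)) :
    ∃ X Y : H →L[ℂ] H, X * Y = 1 ∧ Y * X = 1 ∧
      ∀ j, X * G j = q ^ (∑ i ∈ s, (a i : ℤ) * d i j) • (G j * X) := by
  have hpow : ∀ i j (k : ℕ), K i ^ k * G j = q ^ ((k : ℤ) * d i j) • (G j * K i ^ k) := by
    intro i j k
    induction k with
    | zero => simp
    | succ k ih =>
      rw [pow_succ', mul_assoc, ih, mul_smul_comm, ← mul_assoc, hKG, smul_mul_assoc, smul_smul,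
        ← zpow_add₀ hq, mul_assoc]
      congr 2
      push_cast; ring
  induction s using Finset.induction_on with
  | empty => exact ⟨1, 1, by simp, by simp, by simp⟩
  | insert i s hi ih =>
    obtain ⟨X, Y, h1, h2, h3⟩ := ih
    have hc : Commute (K i) (Kinv i) := (hKinv i).1.trans (hKinv i).2.symm
    have hKp : K i ^ a i * Kinv i ^ a i = 1 := by rw [← hc.mul_pow, (hKinv i).1, one_pow]
    have hKp' : Kinv i ^ a i * K i ^ a i = 1 := by rw [← hc.symm.mul_pow, (hKinv i).2, one_pow]
    refine ⟨K i ^ a i * X, Y * Kinv i ^ a i, ?_, ?_, ?_⟩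
    · rw [mul_assoc, ← mul_assoc X, h1, one_mul, hKp]
    · rw [mul_assoc, ← mul_assoc _ _ X, hKp', one_mul, h2]
    · intro j
      rw [mul_assoc, h3, mul_smul_comm, ← mul_assoc, hpow, smul_mul_assoc, smul_smul,
        ← zpow_add₀ hq, mul_assoc, Finset.sum_insert hi, add_comm]

theorem word_grading {H : Type*} [NormedAddCommGroup H] [InnerProductSpace ℂ H] {m : ℕ}
    (c : ℂ) (X : H →L[ℂ] H) (G : Fin m → (H →L[ℂ] H))
    (h : ∀ j, X * G j = c • (G j * X)) (l : List (Fin m)) :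
    X * (l.map G).prod = c ^ l.length • ((l.map G).prod * X) := by
  induction l with
  | nil => simp
  | cons j l ih =>
    rw [List.map_cons, List.prod_cons, ← mul_assoc, h, smul_mul_assoc, mul_assoc, ih,
      mul_smul_comm, smul_smul, List.length_cons, pow_succ', mul_assoc]

theorem words_vanish {H : Type*} [NormedAddCommGroup H] [InnerProductSpace ℂ H] {n m : ℕ}
    (q : ℝ) (hq0 : 0 < q) (hq1 : q ≠ 1)
    (K Kinv : Fin n → (H →L[ℂ] H)) (G : Fin m → (H →L[ℂ] H))
    (hKinv : ∀ i, K i * Kinv i = 1 ∧ Kinv i * K i = 1)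
    (d : Fin n → Fin m → ℤ)
    (hKG : ∀ i j, K i * G j = (q : ℂ) ^ (d i j) • (G j * K i)) (a : Fin n → ℕ)
    (e : ℤ) (he : e = 1 ∨ e = -1) (ha : ∀ j, ∑ i, (a i : ℤ) * d i j = e) :
    ∃ n0 : ℕ, ∀ l : List (Fin m), n0 ≤ l.length → (l.map G).prod = 0 := by
  have hq : (q : ℂ) ≠ 0 := by exact_mod_cast hq0.ne'
  obtain ⟨X, Y, h1, h2, h3⟩ := exists_grading (q : ℂ) hq K Kinv G hKinv d hKG a Finset.univ
  obtain ⟨n0, hn0⟩ := nilp X Y h1 h2 (q ^ e) (by positivity)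
    (by rcases he with rfl | rfl <;> simp [hq1])
  refine ⟨n0, fun l hl => hn0 _ hl _ ?_⟩
  apply word_grading
  intro j
  rw [h3, ha]
  push_cast
  rfl

end UqAux
namespace UqAux

/-- The span of all words in the `F j` applied to a subspace. -/
def gen {H : Type*} [NormedAddCommGroup H] [InnerProductSpace ℂ H] {m : ℕ}
    (F : Fin m → (H →L[ℂ] H)) (V : Submodule ℂ H) : Submodule ℂ H :=
  ⨆ l : List (Fin m), V.map ((l.map F).prod : H →L[ℂ] H).toLinearMap

theorem mem_gen {H : Type*} [NormedAddCommGroup H] [InnerProductSpace ℂ H] {m : ℕ}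
    (F : Fin m → (H →L[ℂ] H)) (V : Submodule ℂ H) (l : List (Fin m)) (v : H) (hv : v ∈ V) :
    (l.map F).prod v ∈ gen F V :=
  (le_iSup (fun l : List (Fin m) => V.map ((l.map F).prod : H →L[ℂ] H).toLinearMap) l)
    ⟨v, hv, rfl⟩

theorem gen_stable {H : Type*} [NormedAddCommGroup H] [InnerProductSpace ℂ H] {m : ℕ}
    (F : Fin m → (H →L[ℂ] H)) (V : Submodule ℂ H) (T : H →L[ℂ] H) (W : Submodule ℂ H)
    (h : ∀ (l : List (Fin m)) (v : H), v ∈ V → T ((l.map F).prod v) ∈ W) :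
    ∀ x ∈ gen F V, T x ∈ W := by
  have : gen F V ≤ W.comap T.toLinearMap := by
    refine iSup_le fun l => ?_
    rintro _ ⟨v, hv, rfl⟩
    exact h l v hv
  exact fun x hx => this hx

theorem gen_K {H : Type*} [NormedAddCommGroup H] [InnerProductSpace ℂ H] {m : ℕ}
    (F : Fin m → (H →L[ℂ] H)) (V : Submodule ℂ H) (T : H →L[ℂ] H) (c : Fin m → ℂ)
    (hTF : ∀ j, T * F j = c j • (F j * T)) (hT : ∀ v ∈ V, T v ∈ V) :
    ∀ x ∈ gen F V, T x ∈ gen F V := by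
  apply gen_stable
  intro l v hv
  have h : ∃ a : ℂ, T * (l.map F).prod = a • ((l.map F).prod * T) := by
    induction l with
    | nil => exact ⟨1, by simp⟩
    | cons j l ih =>
      obtain ⟨a, ha⟩ := ih
      refine ⟨c j * a, ?_⟩
      rw [List.map_cons, List.prod_cons, ← mul_assoc, hTF, smul_mul_assoc, mul_assoc, ha,
        mul_smul_comm, smul_smul, mul_assoc]
  obtain ⟨a, ha⟩ := h
  have := congrArg (fun S : H →L[ℂ] H => S v) ha
  simp only [ContinuousLinearMap.mul_apply, ContinuousLinearMap.smul_apply] at this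
  rw [this]
  exact Submodule.smul_mem _ _ (mem_gen F V l _ (hT v hv))

theorem gen_F {H : Type*} [NormedAddCommGroup H] [InnerProductSpace ℂ H] {m : ℕ}
    (F : Fin m → (H →L[ℂ] H)) (V : Submodule ℂ H) (j : Fin m) :
    ∀ x ∈ gen F V, F j x ∈ gen F V := by
  apply gen_stable
  intro l v hv
  exact mem_gen F V (j :: l) v hv

theorem gen_E {H : Type*} [NormedAddCommGroup H] [InnerProductSpace ℂ H] {m : ℕ}
    (F : Fin m → (H →L[ℂ] H)) (V : Submodule ℂ H) (T : H →L[ℂ] H) (L : Fin m → (H →L[ℂ] H))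
    (hTF : ∀ j, T * F j - F j * T = L j) (hL : ∀ j, ∀ x ∈ gen F V, L j x ∈ gen F V)
    (hT : ∀ v ∈ V, T v = 0) :
    ∀ x ∈ gen F V, T x ∈ gen F V := by
  apply gen_stable
  intro l v hv
  induction l with
  | nil => simp [hT v hv]
  | cons j l ih =>
    have h : T * F j = F j * T + L j := by rw [← hTF]; abel
    have := congrArg (fun S : H →L[ℂ] H => S ((l.map F).prod v)) h
    simp only [ContinuousLinearMap.mul_apply, ContinuousLinearMap.add_apply] at this
    change T (F j ((l.map F).prod v)) ∈ _
    rw [this]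
    exact Submodule.add_mem _ (gen_F F V j _ ih) (hL j _ (mem_gen F V l v hv))

theorem gen_finite {H : Type*} [NormedAddCommGroup H] [InnerProductSpace ℂ H] {m : ℕ}
    (F : Fin m → (H →L[ℂ] H)) (V : Submodule ℂ H) [FiniteDimensional ℂ V]
    (n0 : ℕ) (hn0 : ∀ l : List (Fin m), n0 ≤ l.length → (l.map F).prod = 0) :
    FiniteDimensional ℂ (gen F V) := by
  have : Finite {l : List (Fin m) // l.length < n0} := (List.finite_length_lt (Fin m) n0).to_subtype
  have hle : gen F V ≤ ⨆ l : {l : List (Fin m) // l.length < n0},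
      V.map ((l.1.map F).prod : H →L[ℂ] H).toLinearMap := by
    refine iSup_le fun l => ?_
    by_cases hl : l.length < n0
    · exact le_iSup (fun l : {l : List (Fin m) // l.length < n0} =>
        V.map ((l.1.map F).prod : H →L[ℂ] H).toLinearMap) ⟨l, hl⟩
    · rintro _ ⟨v, hv, rfl⟩
      rw [hn0 l (not_lt.1 hl)]
      simp
  exact Submodule.finiteDimensional_of_le hle

theorem closure_stable {H : Type*} [NormedAddCommGroup H] [InnerProductSpace ℂ H]
    (W : Submodule ℂ H) (T : H →L[ℂ] H) (h : ∀ x ∈ W, T x ∈ W) (x : H)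
    (hx : x ∈ W.topologicalClosure) : T x ∈ W.topologicalClosure := by
  have : Set.MapsTo T (closure (W : Set H)) (closure (W : Set H)) :=
    Set.MapsTo.closure (fun x hx => h x hx) T.continuous
  exact this hx

end UqAux

theorem Uq_uN_bounded_irreducible_admissible_finiteDimensional
    (m : ℕ) (q : ℝ) (hq0 : 0 < q) (hq1 : q ≠ 1)
    {H : Type*} [NormedAddCommGroup H] [InnerProductSpace ℂ H] [CompleteSpace H]
    [Nontrivial H]
    (K Kinv : Fin (m+1) → (H →L[ℂ] H)) (E F : Fin m → (H →L[ℂ] H))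
    (hKinv : ∀ i, K i * Kinv i = 1 ∧ Kinv i * K i = 1)
    (hKpos : ∀ i, (K i).IsPositive)
    (hKK : ∀ i j, K i * K j = K j * K i)
    (hKE : ∀ (i : Fin (m+1)) (j : Fin m), K i * E j =
      (q : ℂ) ^ (((if i = j.castSucc then 1 else 0)
        - (if i = j.succ then 1 else 0) : ℤ)) • (E j * K i))
    (hKF : ∀ (i : Fin (m+1)) (j : Fin m), K i * F j =
      (q : ℂ) ^ (((if i = j.succ then 1 else 0)
        - (if i = j.castSucc then 1 else 0) : ℤ)) • (F j * K i))
    (hEF : ∀ i j : Fin m, E i * F j - F j * E i =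
      if i = j then ((q : ℂ) - (q : ℂ)⁻¹)⁻¹ •
        (K i.castSucc * Kinv i.succ - K i.succ * Kinv i.castSucc) else 0)
    (hSerreE : ∀ i j : Fin m, ((i : ℕ) = (j : ℕ) + 1 ∨ (j : ℕ) = (i : ℕ) + 1) →
      E i * E i * E j - ((q : ℂ) + (q : ℂ)⁻¹) • (E i * E j * E i)
        + E j * E i * E i = 0)
    (hSerreF : ∀ i j : Fin m, ((i : ℕ) = (j : ℕ) + 1 ∨ (j : ℕ) = (i : ℕ) + 1) →
      F i * F i * F j - ((q : ℂ) + (q : ℂ)⁻¹) • (F i * F j * F i)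
        + F j * F i * F i = 0)
    (hEEfar : ∀ i j : Fin m, (i : ℕ) + 2 ≤ (j : ℕ) → E i * E j = E j * E i)
    (hFFfar : ∀ i j : Fin m, (i : ℕ) + 2 ≤ (j : ℕ) → F i * F j = F j * F i)
    (hEstar : ∀ i : Fin m,
      star (E i) = (q : ℂ)⁻¹ • (F i * (K i.castSucc * Kinv i.succ)))
    (hirr : ∀ W : Submodule ℂ H, IsClosed (W : Set H) →
      (∀ (i : Fin (m+1)) (v : H), v ∈ W → K i v ∈ W) →
      (∀ (i : Fin (m+1)) (v : H), v ∈ W → Kinv i v ∈ W) →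
      (∀ (j : Fin m) (v : H), v ∈ W → E j v ∈ W) →
      (∀ (j : Fin m) (v : H), v ∈ W → F j v ∈ W) →
      W = ⊥ ∨ W = ⊤) :
    FiniteDimensional ℂ H ∧
    ∃ v : H, v ≠ 0 ∧ (∀ j : Fin m, E j v = 0) ∧
      ∀ i : Fin (m+1), ∃ μ : ℝ, 0 < μ ∧ K i v = (μ : ℂ) • v := by
  classical
  have hq : (q : ℂ) ≠ 0 := by exact_mod_cast hq0.ne'
  have app : ∀ {S T : H →L[ℂ] H}, S = T → ∀ x, S x = T x := fun h x => by rw [h]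
  have hKi1 : ∀ i x, K i (Kinv i x) = x := fun i x => app (hKinv i).1 x
  have hKi2 : ∀ i x, Kinv i (K i x) = x := fun i x => app (hKinv i).2 x
  -- inverse commutation relations
  have inv_rel : ∀ (i : Fin (m+1)) (G : H →L[ℂ] H) (c : ℂ), c ≠ 0 → K i * G = c • (G * K i) →
      Kinv i * G = c⁻¹ • (G * Kinv i) := by
    intro i G c hc h
    have h1 : G * Kinv i = c • (Kinv i * G) := by
      calc G * Kinv i = Kinv i * (K i * G) * Kinv i := by
            rw [← mul_assoc, (hKinv i).2, one_mul]
        _ = _ := by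
            rw [h, mul_smul_comm, smul_mul_assoc, mul_assoc, mul_assoc, (hKinv i).1, mul_one]
    rw [h1, smul_smul, inv_mul_cancel₀ hc, one_smul]
  have hKKi : ∀ i j, Kinv i * K j = K j * Kinv i := by
    intro i j
    have := inv_rel i (K j) 1 one_ne_zero (by rw [one_smul, hKK])
    simpa using this
  -- vanishing of long words
  obtain ⟨nE, hnE⟩ := UqAux.words_vanish q hq0 hq1 K Kinv E hKinv _ hKE (fun i => m - i) 1
    (Or.inl rfl) (by
      intro j
      simp only [mul_sub, Finset.sum_sub_distrib, mul_ite, mul_one, mul_zero,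
        Finset.sum_ite_eq', Finset.mem_univ, if_true, Fin.val_castSucc, Fin.val_succ]
      have := j.2
      omega)
  obtain ⟨nF, hnF⟩ := UqAux.words_vanish q hq0 hq1 K Kinv F hKinv _ hKF (fun i => m - i) (-1)
    (Or.inr rfl) (by
      intro j
      simp only [mul_sub, Finset.sum_sub_distrib, mul_ite, mul_one, mul_zero,
        Finset.sum_ite_eq', Finset.mem_univ, if_true, Fin.val_castSucc, Fin.val_succ]
      have := j.2
      omega)
  -- the space of highest weight vectors
  set V : Submodule ℂ H := ⨅ j, LinearMap.ker (E j).toLinearMap with hVdef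
  have memV : ∀ x, x ∈ V ↔ ∀ j, E j x = 0 := by
    intro x; simp [hVdef]
  have hVclosed : IsClosed (V : Set H) := by
    have : (V : Set H) = ⋂ j, {x | E j x = 0} := by
      ext x; simp [memV]
    rw [this]
    exact isClosed_iInter fun j => isClosed_eq (E j).continuous continuous_const
  have hVne : ∃ v ∈ V, v ≠ 0 := by
    have hex : ∃ n, ∀ l : List (Fin m), l.length = n → (l.map E).prod = 0 :=
      ⟨nE, fun l hl => hnE l hl.ge⟩
    obtain ⟨n, hn, hmin⟩ : ∃ n, (∀ l : List (Fin m), l.length = n → (l.map E).prod = 0) ∧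
        ∀ k < n, ¬ ∀ l : List (Fin m), l.length = k → (l.map E).prod = 0 :=
      ⟨Nat.find hex, Nat.find_spec hex, fun k hk => Nat.find_min hex hk⟩
    cases n with
    | zero =>
      have := hn [] rfl
      simp at this
    | succ n =>
      have := hmin n (Nat.lt_succ_self n)
      push Not at this
      obtain ⟨l, hl, hne⟩ := this
      obtain ⟨v, hv⟩ : ∃ v, (l.map E).prod v ≠ 0 := by
        by_contra hcon
        push Not at hcon
        exact hne (ContinuousLinearMap.ext hcon)
      refine ⟨_, (memV _).2 fun j => ?_, hv⟩
      exact app (hn (j :: l) (by simp [hl])) v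
  have hVK : ∀ i, ∀ v ∈ V, K i v ∈ V := by
    intro i v hv
    rw [memV] at hv ⊢
    intro j
    have := app (hKE i j) v
    simp only [ContinuousLinearMap.mul_apply, ContinuousLinearMap.smul_apply, hv j,
      map_zero] at this
    exact (smul_eq_zero.1 this.symm).resolve_left (zpow_ne_zero _ hq)
  have hVKinv : ∀ i, ∀ v ∈ V, Kinv i v ∈ V := by
    intro i v hv
    rw [memV] at hv ⊢
    intro j
    have := app (inv_rel i (E j) _ (zpow_ne_zero _ hq) (hKE i j)) v
    simp only [ContinuousLinearMap.mul_apply, ContinuousLinearMap.smul_apply, hv j,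
      map_zero] at this
    exact (smul_eq_zero.1 this.symm).resolve_left (inv_ne_zero (zpow_ne_zero _ hq))
  -- the adjoint of `F j` kills highest weight vectors
  have hFstar : ∀ j, ∀ v ∈ V, star (F j) v = 0 := by
    intro j v hv
    rw [memV] at hv
    have h1 : (K j.castSucc * Kinv j.succ) * (K j.succ * Kinv j.castSucc) = 1 := by
      rw [mul_assoc, ← mul_assoc (Kinv j.succ), (hKinv _).2, one_mul, (hKinv _).1]
    have h2 := congrArg star h1
    rw [star_mul, star_one] at h2
    have h3 := congrArg star (hEstar j)
    rw [star_star, star_smul, star_mul] at h3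
    have h4 := app h3 v
    rw [hv j, ContinuousLinearMap.smul_apply, ContinuousLinearMap.mul_apply] at h4
    have h5 := (smul_eq_zero.1 h4.symm).resolve_left (by simp [hq])
    have h6 := app h2 (star (F j) v)
    rw [ContinuousLinearMap.mul_apply, h5, map_zero] at h6
    exact h6.symm
  -- invariant subspaces generated by highest weight vectors
  have hgen : ∀ V' : Submodule ℂ H, V' ≤ V → V' ≠ ⊥ → (∀ i, ∀ v ∈ V', K i v ∈ V') →
      (∀ i, ∀ v ∈ V', Kinv i v ∈ V') → (UqAux.gen F V').topologicalClosure = ⊤ := by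
    intro V' hle hne hK' hKinv'
    have gK : ∀ i, ∀ x ∈ UqAux.gen F V', K i x ∈ UqAux.gen F V' := fun i =>
      UqAux.gen_K F V' (K i) _ (hKF i) (hK' i)
    have gKi : ∀ i, ∀ x ∈ UqAux.gen F V', Kinv i x ∈ UqAux.gen F V' := fun i =>
      UqAux.gen_K F V' (Kinv i) _
        (fun j => inv_rel i (F j) _ (zpow_ne_zero _ hq) (hKF i j)) (hKinv' i)
    have gE : ∀ i, ∀ x ∈ UqAux.gen F V', E i x ∈ UqAux.gen F V' := by
      intro i
      refine UqAux.gen_E F V' (E i) _ (hEF i) ?_ (fun v hv => (memV v).1 (hle hv) i)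
      intro j x hx
      split_ifs
      · exact Submodule.smul_mem _ _ (Submodule.sub_mem _ (gK _ _ (gKi _ _ hx))
          (gK _ _ (gKi _ _ hx)))
      · simp
    refine (hirr _ (Submodule.isClosed_topologicalClosure _)
      (fun i => UqAux.closure_stable _ _ (gK i)) (fun i => UqAux.closure_stable _ _ (gKi i))
      (fun i => UqAux.closure_stable _ _ (gE i))
      (fun i => UqAux.closure_stable _ _ (UqAux.gen_F F V' i))).resolve_left ?_
    intro hbot
    apply hne
    rw [eq_bot_iff, ← hbot]
    intro x hx
    exact Submodule.le_topologicalClosure _ (UqAux.mem_gen F V' [] x hx)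
  have horth : ∀ V' : Submodule ℂ H, V' ≤ V → V' ≠ ⊥ → (∀ i, ∀ v ∈ V', K i v ∈ V') →
      (∀ i, ∀ v ∈ V', Kinv i v ∈ V') → ∀ w ∈ V, (∀ v ∈ V', inner ℂ v w = 0) → w = 0 := by
    intro V' hle hne hK' hKinv' w hw hperp
    have h1 : UqAux.gen F V' ≤ (ℂ ∙ w)ᗮ := by
      refine iSup_le fun l => ?_
      rintro _ ⟨v, hv, rfl⟩
      rw [Submodule.mem_orthogonal_singleton_iff_inner_left]
      cases l with
      | nil => exact hperp v hv
      | cons j l =>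
        change inner ℂ (F j ((l.map F).prod v)) w = 0
        rw [← ContinuousLinearMap.adjoint_inner_right, ← ContinuousLinearMap.star_eq_adjoint,
          hFstar j w hw, inner_zero_right]
    have h2 := Submodule.topologicalClosure_minimal _ h1 (Submodule.isClosed_orthogonal _)
    rw [hgen V' hle hne hK' hKinv'] at h2
    have h3 : w ∈ (ℂ ∙ w)ᗮ := h2 trivial
    rw [Submodule.mem_orthogonal_singleton_iff_inner_left] at h3
    exact inner_self_eq_zero.1 h3
  -- each `K i` is scalar on `V`
  have : CompleteSpace V := hVclosed.completeSpace_coe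
  obtain ⟨v, hvV, hv0⟩ := hVne
  have : Nontrivial V := ⟨⟨v, hvV⟩, 0, fun h => hv0 (congrArg Subtype.val h)⟩
  have hscalar : ∀ i, ∃ r : ℝ, ∀ x ∈ V, K i x = (r : ℂ) • x := by
    intro i
    let R : (T : H →L[ℂ] H) → (∀ v ∈ V, T v ∈ V) → (V →L[ℂ] V) := fun T hT =>
      (T.comp V.subtypeL).codRestrict V (fun x => hT x x.2)
    have hR : ∀ T hT (x : V), ((R T hT x : V) : H) = T x := fun T hT x => rfl
    by_contra hcon
    push Not at hcon
    have hsa : IsSelfAdjoint (R (K i) (hVK i)) := by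
      rw [ContinuousLinearMap.isSelfAdjoint_iff_isSymmetric]
      intro x y
      have := (hKpos i).isSelfAdjoint
      rw [ContinuousLinearMap.isSelfAdjoint_iff_isSymmetric] at this
      exact this x y
    obtain ⟨f, g, hf, hf0, hg0, hfg, hcomm⟩ := UqAux.split_selfAdjoint (R (K i) (hVK i)) hsa (by
      intro r h
      obtain ⟨x, hx, hxr⟩ := hcon r
      apply hxr
      have := congrArg (fun S : V →L[ℂ] V => ((S ⟨x, hx⟩ : V) : H)) h
      exact this)
    obtain ⟨x, hx⟩ : ∃ x, f x ≠ 0 := by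
      by_contra hc
      push Not at hc
      exact hf0 (ContinuousLinearMap.ext hc)
    obtain ⟨y, hy⟩ : ∃ y, g y ≠ 0 := by
      by_contra hc
      push Not at hc
      exact hg0 (ContinuousLinearMap.ext hc)
    have hstab : ∀ (T : H →L[ℂ] H) (hT : ∀ v ∈ V, T v ∈ V), K i * T = T * K i →
        ∀ v ∈ (LinearMap.range g.toLinearMap).map V.subtype,
          T v ∈ (LinearMap.range g.toLinearMap).map V.subtype := by
      rintro T hT hKT _ ⟨_, ⟨z, rfl⟩, rfl⟩
      have hc : Commute (R (K i) (hVK i)) (R T hT) := by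
        ext w
        exact app hKT w
      refine ⟨_, ⟨R T hT z, rfl⟩, ?_⟩
      have := congrArg (fun S : V →L[ℂ] V => ((S z : V) : H)) (hcomm _ hc).eq
      exact this
    have := horth ((LinearMap.range g.toLinearMap).map V.subtype) (Submodule.map_subtype_le _ _)
      (by
        intro hbot
        apply hy
        have : ((g y : V) : H) ∈ (LinearMap.range g.toLinearMap).map V.subtype :=
          ⟨_, ⟨y, rfl⟩, rfl⟩
        rw [hbot, Submodule.mem_bot] at this
        exact Subtype.ext this)
      (fun j => hstab (K j) (hVK j) (hKK i j))
      (fun j => hstab (Kinv j) (hVKinv j) (hKKi j i).symm)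
      (f x) (f x).2 (by
        rintro _ ⟨_, ⟨z, rfl⟩, rfl⟩
        change inner ℂ (g z) (f x) = 0
        have hsym := (ContinuousLinearMap.isSelfAdjoint_iff_isSymmetric.1 hf) (g z) x
        have hz : f (g z) = 0 := congrArg (fun S : V →L[ℂ] V => S z) hfg
        change inner ℂ (f (g z)) x = inner ℂ (g z) (f x) at hsym
        rw [← hsym, hz, inner_zero_left])
    exact hx (Subtype.ext this)
  choose r hr using hscalar
  have hr0 : ∀ i, r i ≠ 0 := by
    intro i h
    have h1 := hr i v hvV
    rw [h] at h1
    have h2 := hKi2 i v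
    rw [h1] at h2
    simp at h2
    exact hv0 h2.symm
  have hrpos : ∀ i, 0 < r i := by
    intro i
    refine lt_of_le_of_ne ?_ (hr0 i).symm
    have h1 := (hKpos i).re_inner_nonneg_left v
    rw [hr i v hvV, inner_smul_left, inner_self_eq_norm_sq_to_K] at h1
    have h2 : 0 ≤ r i * ‖v‖ ^ 2 := by
      have h3 : (starRingEnd ℂ) (r i : ℂ) * ((‖v‖ : ℂ)) ^ 2 = ((r i * ‖v‖ ^ 2 : ℝ) : ℂ) := by
        simp
      have h4 : 0 ≤ RCLike.re ((starRingEnd ℂ) (r i : ℂ) * ((‖v‖ : ℂ)) ^ 2) := h1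
      rw [h3] at h4
      exact h4
    exact nonneg_of_mul_nonneg_left h2 (by positivity)
  refine ⟨?_, v, hv0, (memV v).1 hvV, fun i => ⟨r i, hrpos i, hr i v hvV⟩⟩
  have hfin : FiniteDimensional ℂ (UqAux.gen F (ℂ ∙ v)) := UqAux.gen_finite F _ nF hnF
  have htop := hgen (ℂ ∙ v) (by simpa [Submodule.span_singleton_le_iff_mem] using hvV)
    (by simpa using hv0)
    (by
      intro i x hx
      obtain ⟨a, rfl⟩ := Submodule.mem_span_singleton.1 hx
      rw [map_smul, hr i v hvV, smul_smul]
      exact Submodule.smul_mem _ _ (Submodule.mem_span_singleton_self v))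
    (by
      intro i x hx
      obtain ⟨a, rfl⟩ := Submodule.mem_span_singleton.1 hx
      have : Kinv i v = (r i : ℂ)⁻¹ • v := by
        have h1 := hKi2 i v
        rw [hr i v hvV, map_smul] at h1
        have h0 : (r i : ℂ) ≠ 0 := by exact_mod_cast hr0 i
        rw [← h1, smul_smul, inv_mul_cancel₀ h0, one_smul, h1]
      rw [map_smul, this, smul_smul]
      exact Submodule.smul_mem _ _ (Submodule.mem_span_singleton_self v))
  rw [(Submodule.closed_of_finiteDimensional (UqAux.gen F (ℂ ∙ v))).submodule_topologicalClosure_eq]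
    at htop
  rw [htop] at hfin
  exact Module.Finite.equiv (Submodule.topEquiv (R := ℂ) (M := H))
end
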